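/- Let Z_1, …, Z_{n+1} be exchangeable real-valued random variables that are almost surely pairwise distinct, and let α ∈ (0,1) with ⌈(n+1)α⌉ ≤ n. Let Q̂ denote the (1+1/n)α-empirical quantile of Z_1, …, Z_n, i.e. the ⌈(n+1)α⌉-th smallest value among Z_1, …, Z_n. Then P(Z_{n+1} ≤ Q̂) ≤ α + 1/n. -/

import Mathlib

open MeasureTheory Filter

/-- The `k`-th smallest element of a multiset of extended reals (`k` is 1-based), interpreted
as `+∞` when `k` exceeds the number of elements.  For `β > 0`, the `β`-empirical quantile of
`z_1, …, z_m` is `empQuantile {z_1, …, z_m} ⌈β m⌉`. -/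
noncomputable def empQuantile (s : Multiset EReal) (k : ℕ) : EReal :=
  if k ≤ Multiset.card s then (s.sort (· ≤ ·)).getD (k - 1) 0 else ⊤

/-- If `x` is at most the `k`-th smallest of the values of `s`, then fewer than `k` of them
lie strictly below `x`. -/
lemma countP_lt_of_le_empQuantile {s : Multiset EReal} {k : ℕ} (hk : 1 ≤ k)
    (hks : k ≤ Multiset.card s) {x : EReal} (hx : x ≤ empQuantile s k) :
    s.countP (· < x) < k := by
  rw [empQuantile, if_pos hks] at hx
  set l := s.sort (· ≤ ·) with hl
  have hs : s = (l : Multiset EReal) := (Multiset.sort_eq s (· ≤ ·)).symm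
  have hlen : l.length = Multiset.card s := by simp [hl]
  have hsorted : l.Pairwise (· ≤ ·) := Multiset.pairwise_sort s (· ≤ ·)
  have hk' : k - 1 < l.length := by omega
  rw [List.getD_eq_getElem _ _ hk'] at hx
  rw [hs, Multiset.coe_countP, ← List.take_append_drop (k - 1) l, List.countP_append]
  have hdrop : (l.drop (k - 1)).countP (fun y => decide (y < x)) = 0 := by
    rw [List.countP_eq_zero]
    intro y hy
    obtain ⟨i, hi, rfl⟩ := List.mem_iff_getElem.mp hy
    rw [List.getElem_drop]
    have := hsorted.rel_get_of_le (a := ⟨k - 1, hk'⟩)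
      (b := ⟨k - 1 + i, by rw [List.length_drop] at hi; omega⟩) (by simp)
    simpa using hx.trans this
  have htake := List.countP_le_length (p := fun y => decide (y < x)) (l := l.take (k - 1))
  rw [List.length_take] at htake
  omega

/-- At most `k` entries of an injective family have fewer than `k` entries strictly below them. -/
lemma card_filter_card_lt_le {ι : Type*} [Fintype ι] {z : ι → ℝ} (hz : Function.Injective z)
    (k : ℕ) :
    (Finset.univ.filter fun j => (Finset.univ.filter fun i => z i < z j).card < k).card ≤ k := by
  have hstrict : ∀ a b, z a < z b →
      (Finset.univ.filter fun i => z i < z a).card <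
        (Finset.univ.filter fun i => z i < z b).card := by
    intro a b hab
    refine Finset.card_lt_card (Finset.ssubset_iff_of_subset ?_ |>.mpr ⟨a, ?_, ?_⟩)
    · intro i hi
      simp only [Finset.mem_filter, Finset.mem_univ, true_and] at hi ⊢
      exact hi.trans hab
    · simpa using hab
    · simp
  calc _ ≤ (Finset.range k).card := by
        refine Finset.card_le_card_of_injOn
          (fun j => (Finset.univ.filter fun i => z i < z j).card) (by intro j; simp) ?_
        intro a _ b _ hab
        dsimp only at hab
        rcases lt_trichotomy (z a) (z b) with h | h | h
        · exact absurd hab (hstrict a b h).ne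
        · exact hz h
        · exact absurd hab (hstrict b a h).ne'
    _ = k := Finset.card_range k

/-- The event that fewer than `k` coordinates lie strictly below the `j`-th one is measurable. -/
lemma measurableSet_card_lt {ι : Type*} [Fintype ι] (j : ι) (k : ℕ) :
    MeasurableSet {z : ι → ℝ | (Finset.univ.filter fun i => z i < z j).card < k} := by
  simp only [Finset.card_filter]
  refine measurableSet_lt (Finset.measurable_sum _ fun i _ => ?_) measurable_const
  exact Measurable.ite (measurableSet_lt (measurable_pi_apply i) (measurable_pi_apply j))
    measurable_const measurable_const

/-- For an exchangeable law on an almost surely injective finite family, the probability that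
fewer than `k` entries lie strictly below a given one is at most `k` over the number of entries. -/
lemma card_mul_measure_card_lt_le {ι : Type*} [Fintype ι] [DecidableEq ι]
    (μ : Measure (ι → ℝ)) [IsProbabilityMeasure μ]
    (hexch : ∀ π : Equiv.Perm ι, μ.map (fun z i => z (π i)) = μ)
    (hinj : ∀ᵐ z ∂μ, Function.Injective z) (j : ι) (k : ℕ) :
    (Fintype.card ι : ENNReal) *
      μ {z | (Finset.univ.filter fun i => z i < z j).card < k} ≤ k := by
  set A : ι → Set (ι → ℝ) := fun j => {z | (Finset.univ.filter fun i => z i < z j).card < k}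
  have hA : ∀ j, MeasurableSet (A j) := fun j => measurableSet_card_lt j k
  have hsymm : ∀ i, μ (A i) = μ (A j) := by
    intro i
    conv_rhs => rw [← hexch (Equiv.swap i j)]
    rw [Measure.map_apply (by fun_prop) (hA j)]
    congr 1
    ext z
    simp only [A, Set.mem_preimage, Set.mem_ofPred_eq, Equiv.swap_apply_right]
    rw [Finset.card_equiv (Equiv.swap i j) (t := Finset.univ.filter fun l =>
      z (Equiv.swap i j l) < z i)]
    simp
  calc (Fintype.card ι : ENNReal) * μ (A j) = ∑ i, μ (A i) := by simp [hsymm]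
    _ = ∫⁻ z, ∑ i, (A i).indicator 1 z ∂μ := by
        rw [lintegral_finsetSum _ fun i _ => measurable_one.indicator (hA i)]
        simp [lintegral_indicator_one (hA _)]
    _ ≤ ∫⁻ _, (k : ENNReal) ∂μ := by
        refine lintegral_mono_ae (hinj.mono fun z hz => ?_)
        simp only [Set.indicator_apply, Pi.one_apply, Finset.sum_boole]
        exact_mod_cast card_filter_card_lt_le hz k
    _ = k := by simp

/-- Let `Z_1, …, Z_{n+1}` be exchangeable real random variables that are
almost surely pairwise distinct, and let `α ∈ (0,1)` with `⌈(n+1)α⌉ ≤ n`.  Let `Q̂` be the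
`(1+1/n)α`-empirical quantile of `Z_1, …, Z_n`, i.e. the `⌈(n+1)α⌉`-th smallest value among
`Z_1, …, Z_n`.  Then `P(Z_{n+1} ≤ Q̂) ≤ α + 1/n`. -/
theorem coverage_upper_bound_inflated_quantile
    (Ω : Type*) [MeasurableSpace Ω] (P : Measure Ω) [IsProbabilityMeasure P]
    (n : ℕ) (hn : 1 ≤ n)
    (Z : Fin (n + 1) → Ω → ℝ) (hZ : ∀ i, Measurable (Z i))
    (hexch : ∀ π : Equiv.Perm (Fin (n + 1)),
      Measure.map (fun ω i => Z (π i) ω) P = Measure.map (fun ω i => Z i ω) P)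
    (hdistinct : ∀ᵐ ω ∂P, ∀ i j : Fin (n + 1), i ≠ j → Z i ω ≠ Z j ω)
    (α : ℝ) (hα : α ∈ Set.Ioo (0 : ℝ) 1)
    (hk : Nat.ceil (((n : ℝ) + 1) * α) ≤ n) :
    P {ω | ((Z (Fin.last n) ω : ℝ) : EReal) ≤
        empQuantile
          (Multiset.map (fun i : Fin n => ((Z (Fin.castSucc i) ω : ℝ) : EReal))
            Finset.univ.val)
          (Nat.ceil (((n : ℝ) + 1) * α))}
      ≤ ENNReal.ofReal (α + 1 / (n : ℝ)) := by
  set k := Nat.ceil (((n : ℝ) + 1) * α)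
  have hk1 : 1 ≤ k := Nat.one_le_ceil_iff.mpr (mul_pos (by positivity) hα.1)
  have hmeas : Measurable fun ω i => Z i ω := measurable_pi_lambda _ hZ
  set μ := Measure.map (fun ω i => Z i ω) P
  have : IsProbabilityMeasure μ := Measure.isProbabilityMeasure_map hmeas.aemeasurable
  set A : Set (Fin (n + 1) → ℝ) :=
    {z | (Finset.univ.filter fun i => z i < z (Fin.last n)).card < k}
  have hexchμ : ∀ π : Equiv.Perm (Fin (n + 1)), μ.map (fun z i => z (π i)) = μ := fun π => by
    rw [Measure.map_map (by fun_prop) hmeas]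
    exact hexch π
  have hinj : ∀ᵐ z ∂μ, Function.Injective z := by
    have hset : MeasurableSet {z : Fin (n + 1) → ℝ | ∀ i j, i ≠ j → z i ≠ z j} := by
      simp only [Set.ofPred_forall]
      refine .iInter fun i => .iInter fun j => .iInter fun _ => ?_
      exact (measurableSet_eq_fun (measurable_pi_apply i) (measurable_pi_apply j)).compl
    have := (ae_map_iff hmeas.aemeasurable hset).mpr hdistinct
    exact this.mono fun z hz i j hij => by_contra fun h => hz i j h hij
  have hbound := card_mul_measure_card_lt_le μ hexchμ hinj (Fin.last n) k
  rw [Fintype.card_fin] at hbound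
  have hsub : P {ω | ((Z (Fin.last n) ω : ℝ) : EReal) ≤ empQuantile (Multiset.map
      (fun i : Fin n => ((Z (Fin.castSucc i) ω : ℝ) : EReal)) Finset.univ.val) k} ≤ μ A := by
    rw [Measure.map_apply hmeas (measurableSet_card_lt _ _)]
    refine measure_mono fun ω hω => ?_
    have h := countP_lt_of_le_empQuantile hk1 (by simpa using hk) hω
    rw [Multiset.countP_map] at h
    simp only [EReal.coe_lt_coe_iff] at h
    simp only [Set.mem_preimage, Set.mem_ofPred_eq]
    rw [Fin.univ_castSuccEmb, Finset.filter_cons, if_neg (lt_irrefl _), Finset.filter_map,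
      Finset.card_map]
    exact h
  refine hsub.trans ?_
  have hn0 : (0 : ℝ) < n := by exact_mod_cast hn
  have hreal : (n + 1 : ℝ) * μ.real A ≤ k := by
    have := ENNReal.toReal_mono (ENNReal.natCast_ne_top k) hbound
    rw [ENNReal.toReal_mul, ENNReal.toReal_natCast, ENNReal.toReal_natCast] at this
    exact_mod_cast this
  have hceil : (k : ℝ) < (n + 1) * α + 1 :=
    Nat.ceil_lt_add_one (mul_nonneg (by positivity) hα.1.le)
  rw [← ofReal_measureReal]
  refine ENNReal.ofReal_le_ofReal ?_
  have hinv : 1 ≤ (n + 1 : ℝ) * (1 / n) := by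
    field_simp
    linarith
  refine le_of_mul_le_mul_left (a := (n + 1 : ℝ)) ?_ (by positivity)
  linarith [mul_add (n + 1 : ℝ) α (1 / n)]
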